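/- ReLU network computing products of hat functions on a grid (Lemma B.2). Let r, M, m be positive integers and let D(M) := {x_ℓ = (ℓ_j/M)_{j=1,…,r} : ℓ ∈ {0,1,…,M}^r}. There exists a ReLU network Hat^r ∈ F(2 + (m+5)·⌈log₂ r⌉, (r, 6r(M+1)^r, …, 6r(M+1)^r, (M+1)^r), s, 1) with at most s ≤ 49·r²·(M+1)^r·(1 + (m+5)·⌈log₂ r⌉) nonzero parameters, such that Hat^r(x) ∈ [0,1]^{(M+1)^r} for all x ∈ [0,1]^r, for every x = (x₁,…,x_r) ∈ [0,1]^r the vector Hat^r(x), indexed by the grid points x_ℓ ∈ D(M), satisfies max_{x_ℓ ∈ D(M)} |(Hat^r(x))_{x_ℓ} − ∏_{j=1}^r (1/M − |x_j − x_j^ℓ|)_+| ≤ r²·2^{−m}, and moreover for each x_ℓ ∈ D(M) the support of x ↦ (Hat^r(x))_{x_ℓ} is contained in the support of x ↦ ∏_{j=1}^r (1/M − |x_j − x_j^ℓ|)_+. -/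

import Mathlib

open MeasureTheory ProbabilityTheory

noncomputable section

/-! ## ReLU networks -/

/-- The ReLU activation function. -/
def relu (x : ℝ) : ℝ := max x 0

/-- Componentwise shifted ReLU activation `σ_v`. -/
def shiftAct {k : ℕ} (v y : Fin k → ℝ) : Fin k → ℝ := fun j => relu (y j - v j)

/-- Value after applying `W_k σ_{v_k} ⋯ σ_{v_1} W_0` to the input `x`. -/
def netLayers (p : ℕ → ℕ) (W : ∀ i, Matrix (Fin (p (i + 1))) (Fin (p i)) ℝ)
    (v : ∀ i, Fin (p i) → ℝ) (x : Fin (p 0) → ℝ) : (k : ℕ) → Fin (p (k + 1)) → ℝ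
  | 0 => (W 0).mulVec x
  | k + 1 => (W (k + 1)).mulVec (shiftAct (v (k + 1)) (netLayers p W v x k))

/-- The function `x ↦ W_L σ_{v_L} W_{L-1} ⋯ W_1 σ_{v_1} W_0 x` computed by a
network with `L` hidden layers and width vector `p 0, …, p (L+1)`. -/
def networkFun (L : ℕ) (p : ℕ → ℕ) (W : ∀ i, Matrix (Fin (p (i + 1))) (Fin (p i)) ℝ)
    (v : ∀ i, Fin (p i) → ℝ) : (Fin (p 0) → ℝ) → Fin (p (L + 1)) → ℝ :=
  fun x => netLayers p W v x L

/-- Number of nonzero entries of a matrix. -/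
def matSupp {a b : ℕ} (W : Matrix (Fin a) (Fin b) ℝ) : ℕ :=
  {ij : Fin a × Fin b | W ij.1 ij.2 ≠ 0}.ncard

/-- Number of nonzero entries of a vector. -/
def vecSupp {a : ℕ} (v : Fin a → ℝ) : ℕ := {j : Fin a | v j ≠ 0}.ncard

/-- Total number of nonzero network parameters. -/
def totalSparsity (L : ℕ) (p : ℕ → ℕ) (W : ∀ i, Matrix (Fin (p (i + 1))) (Fin (p i)) ℝ)
    (v : ∀ i, Fin (p i) → ℝ) : ℕ :=
  (∑ i ∈ Finset.range (L + 1), matSupp (W i)) + ∑ i ∈ Finset.Icc 1 L, vecSupp (v i)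

/-- `F(L,p)`: network functions with all parameters bounded in absolute value by one. -/
def NetClass (L : ℕ) (p : ℕ → ℕ) : Set ((Fin (p 0) → ℝ) → Fin (p (L + 1)) → ℝ) :=
  {f | ∃ (W : ∀ i, Matrix (Fin (p (i + 1))) (Fin (p i)) ℝ) (v : ∀ i, Fin (p i) → ℝ),
    (∀ i j k, |W i j k| ≤ 1) ∧ (∀ i j, |v i j| ≤ 1) ∧ f = networkFun L p W v}

/-- `F(L,p,s)`: networks with at most `s` nonzero parameters. -/
def SparseNetClass (L : ℕ) (p : ℕ → ℕ) (s : ℕ) :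
    Set ((Fin (p 0) → ℝ) → Fin (p (L + 1)) → ℝ) :=
  {f | ∃ (W : ∀ i, Matrix (Fin (p (i + 1))) (Fin (p i)) ℝ) (v : ∀ i, Fin (p i) → ℝ),
    (∀ i j k, |W i j k| ≤ 1) ∧ (∀ i j, |v i j| ≤ 1) ∧
    totalSparsity L p W v ≤ s ∧ f = networkFun L p W v}

/-- The unit hypercube `[0,1]^r`. -/
def unitCube (r : ℕ) : Set (Fin r → ℝ) := {x | ∀ i, x i ∈ Set.Icc (0 : ℝ) 1}

/-- `F(L,p,s,F)`: sparse networks uniformly bounded by `F` on the unit cube. -/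
def SparseNetClassB (L : ℕ) (p : ℕ → ℕ) (s : ℕ) (F : ℝ) :
    Set ((Fin (p 0) → ℝ) → Fin (p (L + 1)) → ℝ) :=
  {f | f ∈ SparseNetClass L p s ∧ ∀ x ∈ unitCube (p 0), ∀ j, |f x j| ≤ F}

/-- Scalar-valued version of `F(L,p)` for input dimension `din`; membership
forces `p 0 = din`, and is meaningful for `p (L+1) = 1`. -/
def ScalarNetClassD (din L : ℕ) (p : ℕ → ℕ) : Set ((Fin din → ℝ) → ℝ) :=
  {f | ∃ h0 : p 0 = din, ∃ g ∈ NetClass L p,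
    ∀ (x : Fin din → ℝ) (j : Fin (p (L + 1))), f x = g (fun k => x (Fin.cast h0 k)) j}

/-- Scalar-valued version of `F(L,p,s)`. -/
def ScalarSparseNetClassD (din L : ℕ) (p : ℕ → ℕ) (s : ℕ) : Set ((Fin din → ℝ) → ℝ) :=
  {f | ∃ h0 : p 0 = din, ∃ g ∈ SparseNetClass L p s,
    ∀ (x : Fin din → ℝ) (j : Fin (p (L + 1))), f x = g (fun k => x (Fin.cast h0 k)) j}

/-- Scalar-valued version of `F(L,p,s,F)`. -/
def ScalarSparseNetClassBD (din L : ℕ) (p : ℕ → ℕ) (s : ℕ) (F : ℝ) :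
    Set ((Fin din → ℝ) → ℝ) :=
  {f | ∃ h0 : p 0 = din, ∃ g ∈ SparseNetClassB L p s F,
    ∀ (x : Fin din → ℝ) (j : Fin (p (L + 1))), f x = g (fun k => x (Fin.cast h0 k)) j}

/-! ## Hölder balls -/

/-- The largest integer strictly smaller than `β` (for `β > 0`). -/
def strictFloor (β : ℝ) : ℕ := (⌈β⌉ - 1).toNat

/-- Partial derivative in direction `i`. -/
def partialDeriv {r : ℕ} (i : Fin r) (f : (Fin r → ℝ) → ℝ) : (Fin r → ℝ) → ℝ :=
  fun x => fderiv ℝ f x (Pi.single i 1)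

def multiPartialList {r : ℕ} : List (Fin r) → ((Fin r → ℝ) → ℝ) → (Fin r → ℝ) → ℝ
  | [], f => f
  | i :: l, f => partialDeriv i (multiPartialList l f)

/-- Mixed partial derivative `∂^α f` for a multi-index `α`. -/
def multiPartial {r : ℕ} (α : Fin r → ℕ) (f : (Fin r → ℝ) → ℝ) : (Fin r → ℝ) → ℝ :=
  multiPartialList ((List.finRange r).flatMap fun i => List.replicate (α i) i) f

/-- Multi-indices `α` with `|α| < β`. -/
def multiIndicesLt (r : ℕ) (β : ℝ) : Finset (Fin r → ℕ) :=
  (Fintype.piFinset fun _ : Fin r => Finset.range (strictFloor β + 1)).filter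
    fun α => ((∑ i, α i : ℕ) : ℝ) < β

/-- Multi-indices `α` with `|α| = ⌊β⌋` (largest integer `< β`). -/
def multiIndicesEq (r : ℕ) (β : ℝ) : Finset (Fin r → ℕ) :=
  (Fintype.piFinset fun _ : Fin r => Finset.range (strictFloor β + 1)).filter
    fun α => ∑ i, α i = strictFloor β

/-- The Hölder norm appearing in the definition of the ball `C_r^β(D,K)`. -/
def holderNorm (r : ℕ) (β : ℝ) (D : Set (Fin r → ℝ)) (f : (Fin r → ℝ) → ℝ) : ℝ :=
  (∑ α ∈ multiIndicesLt r β, ⨆ x ∈ D, |multiPartial α f x|) +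
  ∑ α ∈ multiIndicesEq r β, ⨆ x ∈ D, ⨆ y ∈ D,
    |multiPartial α f x - multiPartial α f y| / ‖x - y‖ ^ (β - (strictFloor β : ℝ))

/-- The Hölder ball `C_r^β(D,K)`. -/
def HolderBall (r : ℕ) (β K : ℝ) (D : Set (Fin r → ℝ)) : Set ((Fin r → ℝ) → ℝ) :=
  {f | (∀ α : Fin r → ℕ, ∑ i, α i < strictFloor β →
          ∀ x ∈ D, DifferentiableAt ℝ (multiPartial α f) x) ∧
    holderNorm r β D f ≤ K}

/-- Univariate Hölder ball `C_1^α([A,B],K)` for `0 < α ≤ 1`. -/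
def holderBall1 (α K A B : ℝ) : Set (ℝ → ℝ) :=
  {h | (⨆ x ∈ Set.Icc A B, |h x|) +
      (⨆ x ∈ Set.Icc A B, ⨆ y ∈ Set.Icc A B, |h x - h y| / |x - y| ^ α) ≤ K}

/-! ## Composition classes -/

/-- The hypercube `[a,b]^r`. -/
def cube (r : ℕ) (a b : ℝ) : Set (Fin r → ℝ) := {x | ∀ i, x i ∈ Set.Icc a b}

/-- The composition `g_{k-1} ∘ ⋯ ∘ g_0`. -/
def compChain (d : ℕ → ℕ) (g : ∀ i, (Fin (d i) → ℝ) → Fin (d (i + 1)) → ℝ) :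
    (k : ℕ) → (Fin (d 0) → ℝ) → Fin (d k) → ℝ
  | 0 => fun x => x
  | k + 1 => fun x => g k (compChain d g k x)

/-- The composition class `G(q, d, t, β, K)` (with `d 0`-dimensional input on
`[0,1]^{d 0}` and real values, meaningful when `d (q+1) = 1`). -/
def CompositionClass (q : ℕ) (d t : ℕ → ℕ) (β : ℕ → ℝ) (K : ℝ) :
    Set ((Fin (d 0) → ℝ) → ℝ) :=
  {f | ∃ (a b : ℕ → ℝ) (g : ∀ i, (Fin (d i) → ℝ) → Fin (d (i + 1)) → ℝ),
    a 0 = 0 ∧ b 0 = 1 ∧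
    (∀ i ≤ q + 1, |a i| ≤ K ∧ |b i| ≤ K) ∧
    (∀ i ≤ q, ∀ x ∈ cube (d i) (a i) (b i), g i x ∈ cube (d (i + 1)) (a (i + 1)) (b (i + 1))) ∧
    (∀ i ≤ q, ∀ j : Fin (d (i + 1)), ∃ (idx : Fin (t i) → Fin (d i))
        (h : (Fin (t i) → ℝ) → ℝ),
        h ∈ HolderBall (t i) (β i) K (cube (t i) (a i) (b i)) ∧
        ∀ x ∈ cube (d i) (a i) (b i), g i x j = h fun k => x (idx k)) ∧
    ∀ x ∈ cube (d 0) 0 1, ∀ j, f x = compChain d g (q + 1) x j}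

/-! ## Rates -/

/-- Effective smoothness index `β_i^* = β_i ∏_{ℓ=i+1}^q (β_ℓ ∧ 1)`. -/
def betaStar (q : ℕ) (β : ℕ → ℝ) (i : ℕ) : ℝ :=
  β i * ∏ ℓ ∈ Finset.Icc (i + 1) q, min (β ℓ) 1

/-- The rate `φ_n = max_i n^{-2β_i^*/(2β_i^* + t_i)}`. -/
def phiRate (q : ℕ) (t : ℕ → ℕ) (β : ℕ → ℝ) (n : ℕ) : ℝ :=
  (Finset.range (q + 1)).sup' (Finset.nonempty_range_iff.mpr (Nat.succ_ne_zero q))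
    fun i => (n : ℝ) ^ (-(2 * betaStar q β i) / (2 * betaStar q β i + (t i : ℝ)))

/-! ## The nonparametric regression model -/

/-- Sample space carrying the design points `X_1,…,X_n`, the noise `ε_1,…,ε_n`
and an independent copy `X` of the design used to evaluate the prediction risk. -/
abbrev RegOmega (n d : ℕ) : Type :=
  (Fin n → (Fin d → ℝ)) × (Fin n → ℝ) × (Fin d → ℝ)

/-- Law of the data: `X_i` i.i.d. `μX`, `ε_i` i.i.d. `N(0,1)`, `X ∼ μX`, all independent. -/
def regP (n d : ℕ) (μX : Measure (Fin d → ℝ)) : Measure (RegOmega n d) :=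
  (Measure.pi fun _ : Fin n => μX).prod
    ((Measure.pi fun _ : Fin n => gaussianReal 0 1).prod μX)

/-- The observed sample `(X_i, Y_i)_{i=1,…,n}` with `Y_i = f0(X_i) + ε_i`. -/
def sampleOf {n d : ℕ} (f0 : (Fin d → ℝ) → ℝ) (ω : RegOmega n d) :
    Fin n → (Fin d → ℝ) × ℝ :=
  fun i => (ω.1 i, f0 (ω.1 i) + ω.2.1 i)

/-- The prediction error `R(f̂, f0) = E[(f̂(X) - f0(X))²]`. -/
def predRisk (n d : ℕ) (μX : Measure (Fin d → ℝ)) (f0 : (Fin d → ℝ) → ℝ)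
    (fhat : (Fin n → (Fin d → ℝ) × ℝ) → (Fin d → ℝ) → ℝ) : ℝ :=
  ∫ ω, (fhat (sampleOf f0 ω) ω.2.2 - f0 ω.2.2) ^ 2 ∂(regP n d μX)

/-- Empirical risk `n⁻¹ ∑_i (Y_i - f(X_i))²` of a fixed function `f`. -/
def empRisk {n d : ℕ} (ω : RegOmega n d) (f0 f : (Fin d → ℝ) → ℝ) : ℝ :=
  (1 / (n : ℝ)) * ∑ i : Fin n, (f0 (ω.1 i) + ω.2.1 i - f (ω.1 i)) ^ 2

/-- `Δ_n(f̂,f0)`: expected gap between the empirical risk of `f̂` and the minimal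
empirical risk over the class `C`. -/
def deltaN (n d : ℕ) (μX : Measure (Fin d → ℝ)) (f0 : (Fin d → ℝ) → ℝ)
    (fhat : (Fin n → (Fin d → ℝ) × ℝ) → (Fin d → ℝ) → ℝ)
    (C : Set ((Fin d → ℝ) → ℝ)) : ℝ :=
  ∫ ω, (empRisk ω f0 (fhat (sampleOf f0 ω)) - ⨅ f ∈ C, empRisk ω f0 f) ∂(regP n d μX)


/-! ## Piecewise linear approximation of the square and of the product -/

lemma relu_of_nonneg {x : ℝ} (h : 0 ≤ x) : relu x = x := max_eq_left h

/-- The `k`-fold iterated tent map, rescaled to take values in `[0, 4⁻ᵏ]` on `[0,1]`. -/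
def scaledTent : ℕ → ℝ → ℝ
  | 0, x => x
  | k + 1, x => scaledTent k x / 2 - relu (scaledTent k x - (1 / 4) ^ k / 2)

/-- The piecewise linear interpolation of `x ↦ x²` at the multiples of `2⁻ᵏ` in `[0,1]`. -/
def squareInterp : ℕ → ℝ → ℝ
  | 0, x => x
  | k + 1, x => squareInterp k x - scaledTent (k + 1) x

lemma scaledTent_mem (k : ℕ) {x : ℝ} (hx : x ∈ Set.Icc (0 : ℝ) 1) :
    scaledTent k x ∈ Set.Icc (0 : ℝ) ((1 / 4) ^ k) := by
  induction k with
  | zero => simpa [scaledTent] using hx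
  | succ k ih =>
    obtain ⟨h0, h1⟩ := ih
    simp only [scaledTent, relu, pow_succ, Set.mem_Icc]
    rcases max_cases (scaledTent k x - (1 / 4) ^ k / 2) 0 with ⟨h, h'⟩ | ⟨h, h'⟩ <;>
      rw [h] <;> constructor <;> linarith

lemma squareInterp_eq (k : ℕ) (x : ℝ) :
    squareInterp k x = x ^ 2 + scaledTent k x * (1 - 4 ^ k * scaledTent k x) := by
  induction k with
  | zero => simp only [squareInterp, scaledTent]; ring
  | succ k ih =>
    have h4 : (4 : ℝ) ^ k * (1 / 4) ^ k = 1 := by rw [← mul_pow]; norm_num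
    simp only [squareInterp, ih, scaledTent, relu, pow_succ]
    set t := scaledTent k x
    set c : ℝ := (1 / 4) ^ k
    set d : ℝ := 4 ^ k
    rcases max_cases (t - c / 2) 0 with ⟨h, h'⟩ | ⟨h, h'⟩ <;> rw [h]
    · linear_combination (c - 2 * t) * h4
    · ring

lemma squareInterp_sub_sq_mem (k : ℕ) {x : ℝ} (hx : x ∈ Set.Icc (0 : ℝ) 1) :
    squareInterp k x - x ^ 2 ∈ Set.Icc (0 : ℝ) ((1 / 4) ^ k) := by
  have h4 : (4 : ℝ) ^ k * (1 / 4) ^ k = 1 := by rw [← mul_pow]; norm_num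
  obtain ⟨h0, h1⟩ := scaledTent_mem k hx
  have hd : (0 : ℝ) < 4 ^ k := by positivity
  have h2 : 4 ^ k * scaledTent k x ≤ 1 := by rw [← h4]; gcongr
  have h3 : 0 ≤ 4 ^ k * scaledTent k x := by positivity
  rw [squareInterp_eq]
  constructor
  · nlinarith
  · nlinarith

lemma squareInterp_le (k : ℕ) {x : ℝ} (hx : x ∈ Set.Icc (0 : ℝ) 1) : squareInterp k x ≤ x := by
  induction k with
  | zero => exact le_rfl
  | succ k ih =>
    have := (scaledTent_mem (k + 1) hx).1
    simp only [squareInterp]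
    linarith

lemma abs_scaledTent_sub_le (k : ℕ) (x y : ℝ) :
    |scaledTent k x - scaledTent k y| ≤ (1 / 2) ^ k * |x - y| := by
  induction k with
  | zero => simp [scaledTent]
  | succ k ih =>
    refine le_trans ?_ (by rw [pow_succ]; linarith :
      1 / 2 * |scaledTent k x - scaledTent k y| ≤ (1 / 2) ^ (k + 1) * |x - y|)
    simp only [scaledTent, relu]
    set t := scaledTent k x
    set s := scaledTent k y
    set c : ℝ := (1 / 4) ^ k
    rw [abs_le]
    rcases max_cases (t - c / 2) 0 with ⟨h, h'⟩ | ⟨h, h'⟩ <;>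
    rcases max_cases (s - c / 2) 0 with ⟨g, g'⟩ | ⟨g, g'⟩ <;>
    rcases abs_cases (t - s) with ⟨a, a'⟩ | ⟨a, a'⟩ <;>
      rw [h, g, a] <;> constructor <;> linarith

lemma le_squareInterp_sub (k : ℕ) {x y : ℝ} (h : x ≤ y) :
    (1 / 2) ^ k * (y - x) ≤ squareInterp k y - squareInterp k x := by
  induction k with
  | zero => simp [squareInterp]
  | succ k ih =>
    have h1 := (abs_le.1 (abs_scaledTent_sub_le (k + 1) y x)).2
    rw [abs_of_nonneg (sub_nonneg.2 h), pow_succ] at h1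
    rw [pow_succ]
    simp only [squareInterp]
    linarith

/-- Piecewise linear approximation of `(x, y) ↦ x * y` on `[0,1]²` obtained by polarization. -/
def approxMul (n : ℕ) (x y : ℝ) : ℝ :=
  squareInterp n ((x + y) / 2) - squareInterp n (|x - y| / 2)

section approxMul

variable {x y : ℝ}

lemma half_add_mem (hx : x ∈ Set.Icc (0 : ℝ) 1) (hy : y ∈ Set.Icc (0 : ℝ) 1) :
    (x + y) / 2 ∈ Set.Icc (0 : ℝ) 1 :=
  ⟨by linarith [hx.1, hy.1], by linarith [hx.2, hy.2]⟩

lemma half_abs_sub_le (hx : 0 ≤ x) (hy : 0 ≤ y) : |x - y| / 2 ≤ (x + y) / 2 := by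
  rcases abs_cases (x - y) with ⟨h, _⟩ | ⟨h, _⟩ <;> rw [h] <;> linarith

lemma half_abs_sub_mem (hx : x ∈ Set.Icc (0 : ℝ) 1) (hy : y ∈ Set.Icc (0 : ℝ) 1) :
    |x - y| / 2 ∈ Set.Icc (0 : ℝ) 1 :=
  ⟨by positivity, (half_abs_sub_le hx.1 hy.1).trans (half_add_mem hx hy).2⟩

lemma approxMul_mem (n : ℕ) (hx : x ∈ Set.Icc (0 : ℝ) 1) (hy : y ∈ Set.Icc (0 : ℝ) 1) :
    approxMul n x y ∈ Set.Icc (0 : ℝ) 1 := by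
  have h := half_abs_sub_le hx.1 hy.1
  have h1 := le_squareInterp_sub n h
  have h2 : 0 ≤ (1 / 2 : ℝ) ^ n * ((x + y) / 2 - |x - y| / 2) :=
    mul_nonneg (by positivity) (sub_nonneg.2 h)
  have h3 := squareInterp_le n (half_add_mem hx hy)
  have h4 := (squareInterp_sub_sq_mem n (half_abs_sub_mem hx hy)).1
  have h5 := (half_add_mem hx hy).2
  unfold approxMul
  exact ⟨by linarith, by nlinarith [sq_nonneg (|x - y| / 2)]⟩

lemma abs_approxMul_sub_le (n : ℕ) (hx : x ∈ Set.Icc (0 : ℝ) 1) (hy : y ∈ Set.Icc (0 : ℝ) 1) :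
    |approxMul n x y - x * y| ≤ (1 / 4) ^ n := by
  have h1 := squareInterp_sub_sq_mem n (half_add_mem hx hy)
  have h2 := squareInterp_sub_sq_mem n (half_abs_sub_mem hx hy)
  have h3 : ((x + y) / 2) ^ 2 - (|x - y| / 2) ^ 2 = x * y := by
    rw [div_pow |x - y|, sq_abs]; ring
  unfold approxMul
  rw [abs_le]
  constructor <;> linarith [h1.1, h1.2, h2.1, h2.2]

lemma approxMul_eq_zero (n : ℕ) (hx : 0 ≤ x) (hy : 0 ≤ y) (h : x = 0 ∨ y = 0) :
    approxMul n x y = 0 := by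
  rcases h with rfl | rfl
  · simp [approxMul, abs_of_nonneg hy]
  · simp [approxMul, abs_of_nonneg hx]

end approxMul

/-! ## Iterated pairwise products -/

/-- Binary tree of approximate products of `a 0, a 1, …`; the entry with index `i` on level `t`
approximates the product of the `2ᵗ` factors starting with `a (i * 2ᵗ)`. Entries with index at
least `r` are set to `1`. -/
def mulTree (r n : ℕ) (a : ℕ → ℝ) : ℕ → ℕ → ℝ
  | 0, i => a i
  | t + 1, i =>
    if i < r then approxMul n (mulTree r n a t (2 * i)) (mulTree r n a t (2 * i + 1)) else 1

section mulTree

variable {r : ℕ} (n : ℕ) {a : ℕ → ℝ}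

lemma mulTree_mem (ha : ∀ i, a i ∈ Set.Icc (0 : ℝ) 1) (t i : ℕ) :
    mulTree r n a t i ∈ Set.Icc (0 : ℝ) 1 := by
  induction t generalizing i with
  | zero => exact ha i
  | succ t ih =>
    simp only [mulTree]
    split_ifs
    · exact approxMul_mem n (ih _) (ih _)
    · simp

lemma mulTree_of_le (har : ∀ i, r ≤ i → a i = 1) (t : ℕ) {i : ℕ} (hi : r ≤ i) :
    mulTree r n a t i = 1 := by
  cases t with
  | zero => exact har i hi
  | succ t => simp [mulTree, hi.not_gt]

lemma prod_block_succ (a : ℕ → ℝ) (t i : ℕ) :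
    ∏ j ∈ Finset.range (2 ^ (t + 1)), a (i * 2 ^ (t + 1) + j) =
      (∏ j ∈ Finset.range (2 ^ t), a (2 * i * 2 ^ t + j)) *
        ∏ j ∈ Finset.range (2 ^ t), a ((2 * i + 1) * 2 ^ t + j) := by
  rw [pow_succ, mul_two, Finset.prod_range_add]
  congr 1 <;> refine Finset.prod_congr rfl fun j _ => congrArg a ?_ <;> ring

lemma prod_block_mem (ha : ∀ i, a i ∈ Set.Icc (0 : ℝ) 1) (t i : ℕ) :
    ∏ j ∈ Finset.range (2 ^ t), a (i * 2 ^ t + j) ∈ Set.Icc (0 : ℝ) 1 :=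
  ⟨Finset.prod_nonneg fun _ _ => (ha _).1,
    Finset.prod_le_one (fun _ _ => (ha _).1) fun _ _ => (ha _).2⟩

lemma prod_block_of_le (har : ∀ i, r ≤ i → a i = 1) (t : ℕ) {i : ℕ} (hi : r ≤ i) :
    ∏ j ∈ Finset.range (2 ^ t), a (i * 2 ^ t + j) = 1 :=
  Finset.prod_eq_one fun j _ => har _ <| by
    have := Nat.le_mul_of_pos_right i (Nat.two_pow_pos t)
    omega

lemma abs_mulTree_sub_le (ha : ∀ i, a i ∈ Set.Icc (0 : ℝ) 1) (har : ∀ i, r ≤ i → a i = 1)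
    (t i : ℕ) :
    |mulTree r n a t i - ∏ j ∈ Finset.range (2 ^ t), a (i * 2 ^ t + j)| ≤
      (2 ^ t - 1) * (1 / 4) ^ n := by
  induction t generalizing i with
  | zero => simp [mulTree]
  | succ t ih =>
    rcases lt_or_ge i r with hi | hi
    · rw [prod_block_succ]
      simp only [mulTree, hi, if_true]
      have hx := mulTree_mem (r := r) n ha t (2 * i)
      have hy := mulTree_mem (r := r) n ha t (2 * i + 1)
      have hP := prod_block_mem ha t (2 * i)
      have hQ := prod_block_mem ha t (2 * i + 1)
      have h1 := abs_approxMul_sub_le n hx hy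
      have h2 := ih (2 * i)
      have h3 := ih (2 * i + 1)
      set x := mulTree r n a t (2 * i)
      set y := mulTree r n a t (2 * i + 1)
      set P := ∏ j ∈ Finset.range (2 ^ t), a (2 * i * 2 ^ t + j)
      set Q := ∏ j ∈ Finset.range (2 ^ t), a ((2 * i + 1) * 2 ^ t + j)
      have h4 : |x * (y - Q)| ≤ |y - Q| := by
        rw [abs_mul, abs_of_nonneg hx.1]
        exact mul_le_of_le_one_left (abs_nonneg _) hx.2
      have h5 : |(x - P) * Q| ≤ |x - P| := by
        rw [abs_mul, abs_of_nonneg hQ.1]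
        exact mul_le_of_le_one_right (abs_nonneg _) hQ.2
      calc |approxMul n x y - P * Q|
          = |(approxMul n x y - x * y) + x * (y - Q) + (x - P) * Q| := by congr 1; ring
        _ ≤ |approxMul n x y - x * y| + |x * (y - Q)| + |(x - P) * Q| := abs_add_three _ _ _
        _ ≤ (2 ^ (t + 1) - 1) * (1 / 4) ^ n := by rw [pow_succ]; linarith
    · rw [mulTree_of_le n har _ hi, prod_block_of_le har _ hi, sub_self, abs_zero]
      exact mul_nonneg (sub_nonneg.2 (one_le_pow₀ one_le_two)) (by positivity)

lemma mulTree_eq_zero (ha : ∀ i, a i ∈ Set.Icc (0 : ℝ) 1) (har : ∀ i, r ≤ i → a i = 1)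
    (t i : ℕ) (h : ∏ j ∈ Finset.range (2 ^ t), a (i * 2 ^ t + j) = 0) :
    mulTree r n a t i = 0 := by
  induction t generalizing i with
  | zero => simpa [mulTree] using h
  | succ t ih =>
    rcases lt_or_ge i r with hi | hi
    · rw [prod_block_succ, mul_eq_zero] at h
      simp only [mulTree, hi, if_true]
      exact approxMul_eq_zero n (mulTree_mem n ha _ _).1 (mulTree_mem n ha _ _).1
        (h.imp (ih _) (ih _))
    · rw [prod_block_of_le har _ hi] at h
      exact absurd h one_ne_zero

end mulTree

/-! ## Neurons and chains of layers -/

/-- `f` is the output of a neuron reading the functions `F`, with at most `c` nonzero weights and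
all parameters bounded by one. -/
def IsNeuron {ι X : Type*} [Fintype ι] (c : ℕ) (F : ι → X → ℝ) (f : X → ℝ) : Prop :=
  ∃ (w : ι → ℝ) (b : ℝ), (∀ i, |w i| ≤ 1) ∧ |b| ≤ 1 ∧ {i | w i ≠ 0}.ncard ≤ c ∧
    ∀ x, f x = relu (∑ i, w i * F i x - b)

/-- `G` is obtained from `F` by applying `n` layers of neurons of in-degree at most `c`. -/
inductive LayerChain {ι X : Type*} [Fintype ι] (c : ℕ) (F : ι → X → ℝ) :
    ℕ → (ι → X → ℝ) → Prop
  | refl : LayerChain c F 0 F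
  | step {n : ℕ} {G H : ι → X → ℝ} (h : LayerChain c F n G) (hH : ∀ i, IsNeuron c G (H i)) :
    LayerChain c F (n + 1) H

section Chain

variable {ι κ X : Type*} [Fintype ι] [Fintype κ] {c : ℕ}

lemma isNeuron_zero (F : ι → X → ℝ) : IsNeuron c F 0 :=
  ⟨0, 0, by simp, by simp, by simp, by simp [relu]⟩

lemma IsNeuron.of_embedding (e : κ ↪ ι) {F : ι → X → ℝ} {f : X → ℝ}
    (h : IsNeuron c (fun k => F (e k)) f) : IsNeuron c F f := by
  classical
  obtain ⟨w, b, hw, hb, hc, hf⟩ := h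
  have he : ∀ k, Function.extend e w 0 (e k) = w k := fun k => e.injective.extend_apply _ _ _
  have h0 : ∀ i, i ∉ Set.range e → Function.extend e w 0 i = 0 := fun i hi =>
    Function.extend_apply' _ _ _ hi
  refine ⟨Function.extend e w 0, b, fun i => ?_, hb, ?_, fun x => ?_⟩
  · by_cases hi : i ∈ Set.range e
    · obtain ⟨k, rfl⟩ := hi
      rw [he]
      exact hw k
    · simp [h0 i hi]
  · refine le_trans (le_trans (Set.ncard_le_ncard (t := e '' {k | w k ≠ 0}) ?_) ?_) hc
    · intro i hi
      by_cases hr : i ∈ Set.range e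
      · obtain ⟨k, rfl⟩ := hr
        exact ⟨k, by simpa [he] using hi, rfl⟩
      · exact absurd (h0 i hr) hi
    · exact Set.ncard_image_le
  · rw [hf]
    congr 2
    have hmap := Finset.sum_map Finset.univ e fun i => Function.extend e w 0 i * F i x
    simp only [he] at hmap
    rw [← hmap]
    refine Finset.sum_subset (Finset.subset_univ _) fun i _ hi => ?_
    rw [h0 i (by simpa using hi), zero_mul]

lemma isNeuron_card (F : ι → X → ℝ) {f : X → ℝ} (w : ι → ℝ) (b : ℝ) (hw : ∀ i, |w i| ≤ 1)
    (hb : |b| ≤ 1) (hf : ∀ x, f x = relu (∑ i, w i * F i x - b)) :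
    IsNeuron (Fintype.card ι) F f :=
  ⟨w, b, hw, hb, by simpa [Nat.card_eq_fintype_card] using Set.ncard_le_card {i | w i ≠ 0}, hf⟩

lemma LayerChain.trans {F G H : ι → X → ℝ} {m n : ℕ} (h₁ : LayerChain c F m G)
    (h₂ : LayerChain c G n H) : LayerChain c F (m + n) H := by
  induction h₂ with
  | refl => exact h₁
  | step _ hH ih => exact ih.step hH

lemma LayerChain.single {F G : ι → X → ℝ} (h : ∀ i, IsNeuron c F (G i)) : LayerChain c F 1 G :=
  LayerChain.refl.step h

lemma layerChain_zero_iff {F G : ι → X → ℝ} : LayerChain c F 0 G ↔ G = F :=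
  ⟨fun h => by cases h; rfl, by rintro rfl; exact .refl⟩

lemma LayerChain.prod {n : ℕ} {F G : κ → ι → X → ℝ} (h : ∀ k, LayerChain c (F k) n (G k)) :
    LayerChain c (fun q : κ × ι => F q.1 q.2) n (fun q => G q.1 q.2) := by
  induction n generalizing G with
  | zero =>
    have : G = F := funext fun k => layerChain_zero_iff.1 (h k)
    rw [this]
    exact .refl
  | succ n ih =>
    have : ∀ k, ∃ H, LayerChain c (F k) n H ∧ ∀ i, IsNeuron c H (G k i) := fun k => by
      cases h k with
      | step h hH => exact ⟨_, h, hH⟩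
    choose H hH hG using this
    exact (ih hH).step fun q =>
      (hG q.1 q.2).of_embedding (F := fun q => H q.1 q.2) (Function.Embedding.sectR q.1 ι)

lemma LayerChain.exists_seq {n : ℕ} {F G : ι → X → ℝ} (h : LayerChain c F n G) :
    ∃ T : ℕ → ι → X → ℝ, T 0 = F ∧ T n = G ∧
      ∀ k < n, ∀ i, IsNeuron c (T k) (T (k + 1) i) := by
  induction h with
  | refl => exact ⟨fun _ => F, rfl, rfl, by simp⟩
  | @step n G H h hH ih =>
    obtain ⟨T, h0, hn, hT⟩ := ih
    refine ⟨Function.update T (n + 1) H, by simp [h0], by simp, fun k hk i => ?_⟩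
    rw [Function.update_of_ne (by omega)]
    rcases Nat.lt_succ_iff_lt_or_eq.1 hk with hk' | rfl
    · rw [Function.update_of_ne (by omega)]
      exact hT k hk' i
    · rw [Function.update_self, hn]
      exact hH i

end Chain

/-! ## Product networks -/

section Product

variable {X : Type*}

/-- The state of the network computing `approxMul` after `n` tent iterations. -/
def mulState (n : ℕ) (u v : X → ℝ) : Fin 6 → X → ℝ :=
  ![fun x => approxMul n (u x) (v x),
    fun x => scaledTent n ((u x + v x) / 2) / 2,
    fun x => relu (scaledTent n ((u x + v x) / 2) - (1 / 4) ^ n / 2),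
    fun x => scaledTent n (|u x - v x| / 2) / 2,
    fun x => relu (scaledTent n (|u x - v x| / 2) - (1 / 4) ^ n / 2),
    0]

lemma abs_quarter_pow_div_two_le (n : ℕ) : |(1 / 4 : ℝ) ^ n / 2| ≤ 1 := by
  have : (1 / 4 : ℝ) ^ n ≤ 1 := pow_le_one₀ (by norm_num) (by norm_num)
  rw [abs_of_nonneg (by positivity)]
  linarith

lemma isNeuron_mulState_succ {u v : X → ℝ} (hu : ∀ x, u x ∈ Set.Icc (0 : ℝ) 1)
    (hv : ∀ x, v x ∈ Set.Icc (0 : ℝ) 1) (n : ℕ) (i : Fin 6) :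
    IsNeuron 6 (mulState n u v) (mulState (n + 1) u v i) := by
  have ha x := (scaledTent_mem (n + 1) (half_add_mem (hu x) (hv x))).1
  have hb x := (scaledTent_mem (n + 1) (half_abs_sub_mem (hu x) (hv x))).1
  have hm x := (approxMul_mem (n + 1) (hu x) (hv x)).1
  fin_cases i
  · refine isNeuron_card _ ![1, -1, 1, 1, -1, 0] 0 (fun i => by fin_cases i <;> simp) (by simp)
      fun x => (relu_of_nonneg (hm x)).symm.trans (congrArg relu ?_)
    simp only [Fin.sum_univ_six, mulState, Matrix.cons_val, approxMul, squareInterp, scaledTent]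
    ring
  · refine isNeuron_card _ ![0, 1 / 2, -1 / 2, 0, 0, 0] 0
      (fun i => by fin_cases i <;> norm_num [abs_le]) (by simp)
      fun x => (relu_of_nonneg (div_nonneg (ha x) zero_le_two)).symm.trans (congrArg relu ?_)
    simp only [Fin.sum_univ_six, mulState, Matrix.cons_val, scaledTent]
    ring
  · refine isNeuron_card _ ![0, 1, -1, 0, 0, 0] _ (fun i => by fin_cases i <;> simp)
      (abs_quarter_pow_div_two_le (n + 1)) fun x => congrArg relu ?_
    simp only [Fin.sum_univ_six, mulState, Matrix.cons_val, scaledTent]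
    ring
  · refine isNeuron_card _ ![0, 0, 0, 1 / 2, -1 / 2, 0] 0
      (fun i => by fin_cases i <;> norm_num [abs_le]) (by simp)
      fun x => (relu_of_nonneg (div_nonneg (hb x) zero_le_two)).symm.trans (congrArg relu ?_)
    simp only [Fin.sum_univ_six, mulState, Matrix.cons_val, scaledTent]
    ring
  · refine isNeuron_card _ ![0, 0, 0, 1, -1, 0] _ (fun i => by fin_cases i <;> simp)
      (abs_quarter_pow_div_two_le (n + 1)) fun x => congrArg relu ?_
    simp only [Fin.sum_univ_six, mulState, Matrix.cons_val, scaledTent]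
    ring
  · exact isNeuron_zero _

/-- The first layer of the network computing `approxMul`. -/
def mulFirst (u v : X → ℝ) : Fin 6 → X → ℝ :=
  ![fun x => (u x + v x) / 2, fun x => relu ((u x - v x) / 2), fun x => relu ((v x - u x) / 2),
    0, 0, 0]

lemma abs_div_two_eq_relu_add_relu (y : ℝ) : |y| / 2 = relu (y / 2) + relu (-y / 2) := by
  unfold relu
  rcases abs_cases y with ⟨h, h'⟩ | ⟨h, h'⟩ <;> rw [h]
  · rw [max_eq_left (by linarith), max_eq_right (by linarith)]; ring
  · rw [max_eq_right (by linarith), max_eq_left (by linarith)]; ring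

lemma isNeuron_mulFirst {F : Fin 6 → X → ℝ} (h0 : ∀ x, F 0 x ∈ Set.Icc (0 : ℝ) 1)
    (h1 : ∀ x, F 1 x ∈ Set.Icc (0 : ℝ) 1) (i : Fin 6) :
    IsNeuron 6 F (mulFirst (F 0) (F 1) i) := by
  have ha x := (half_add_mem (h0 x) (h1 x)).1
  fin_cases i
  · refine isNeuron_card _ ![1 / 2, 1 / 2, 0, 0, 0, 0] 0
      (fun i => by fin_cases i <;> norm_num [abs_le]) (by simp)
      fun x => (relu_of_nonneg (ha x)).symm.trans (congrArg relu ?_)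
    simp only [Fin.sum_univ_six, Matrix.cons_val]
    ring
  · refine isNeuron_card _ ![1 / 2, -1 / 2, 0, 0, 0, 0] 0
      (fun i => by fin_cases i <;> norm_num [abs_le]) (by simp) fun x => congrArg relu ?_
    simp only [Fin.sum_univ_six, Matrix.cons_val]
    ring
  · refine isNeuron_card _ ![-1 / 2, 1 / 2, 0, 0, 0, 0] 0
      (fun i => by fin_cases i <;> norm_num [abs_le]) (by simp) fun x => congrArg relu ?_
    simp only [Fin.sum_univ_six, Matrix.cons_val]
    ring
  all_goals exact isNeuron_zero _

lemma isNeuron_mulState_zero {u v : X → ℝ} (hu : ∀ x, u x ∈ Set.Icc (0 : ℝ) 1)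
    (hv : ∀ x, v x ∈ Set.Icc (0 : ℝ) 1) (i : Fin 6) :
    IsNeuron 6 (mulFirst u v) (mulState 0 u v i) := by
  have ha x := (half_add_mem (hu x) (hv x)).1
  have hb x := (half_abs_sub_mem (hu x) (hv x)).1
  have hm x := (approxMul_mem 0 (hu x) (hv x)).1
  have hr x : |u x - v x| / 2 = relu ((u x - v x) / 2) + relu ((v x - u x) / 2) := by
    rw [abs_div_two_eq_relu_add_relu, neg_sub]
  fin_cases i
  · refine isNeuron_card _ ![1, -1, -1, 0, 0, 0] 0 (fun i => by fin_cases i <;> simp) (by simp)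
      fun x => (relu_of_nonneg (hm x)).symm.trans (congrArg relu ?_)
    simp only [Fin.sum_univ_six, mulFirst, Matrix.cons_val, approxMul, squareInterp, hr]
    ring
  · refine isNeuron_card _ ![1 / 2, 0, 0, 0, 0, 0] 0
      (fun i => by fin_cases i <;> norm_num [abs_le]) (by simp)
      fun x => (relu_of_nonneg (div_nonneg (ha x) zero_le_two)).symm.trans (congrArg relu ?_)
    simp only [Fin.sum_univ_six, mulFirst, Matrix.cons_val]
    ring
  · refine isNeuron_card _ ![1, 0, 0, 0, 0, 0] _ (fun i => by fin_cases i <;> simp)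
      (abs_quarter_pow_div_two_le 0) fun x => congrArg relu ?_
    simp only [Fin.sum_univ_six, mulFirst, Matrix.cons_val, scaledTent]
    ring
  · refine isNeuron_card _ ![0, 1 / 2, 1 / 2, 0, 0, 0] 0
      (fun i => by fin_cases i <;> norm_num [abs_le]) (by simp)
      fun x => (relu_of_nonneg (div_nonneg (hb x) zero_le_two)).symm.trans (congrArg relu ?_)
    simp only [Fin.sum_univ_six, mulFirst, Matrix.cons_val, hr]
    ring
  · refine isNeuron_card _ ![0, 1, 1, 0, 0, 0] _ (fun i => by fin_cases i <;> simp)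
      (abs_quarter_pow_div_two_le 0) fun x => congrArg relu ?_
    simp only [Fin.sum_univ_six, mulFirst, Matrix.cons_val, scaledTent, hr]
    ring
  · exact isNeuron_zero _

lemma layerChain_mulState (n : ℕ) {F : Fin 6 → X → ℝ} (h0 : ∀ x, F 0 x ∈ Set.Icc (0 : ℝ) 1)
    (h1 : ∀ x, F 1 x ∈ Set.Icc (0 : ℝ) 1) :
    LayerChain 6 F (n + 2) (mulState n (F 0) (F 1)) := by
  induction n with
  | zero => exact (LayerChain.single (isNeuron_mulFirst h0 h1)).step (isNeuron_mulState_zero h0 h1)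
  | succ n ih => exact ih.step (isNeuron_mulState_succ h0 h1 n)

/-- Moves the entries of consecutive pairs of slots into common slots, padding with `1`. -/
def pairUp (r : ℕ) (b : ℕ → X → ℝ) (q : Fin r × Fin 6) : X → ℝ :=
  ![b (2 * q.1), b (2 * q.1 + 1), 0, 0, 0, 0] q.2

lemma isNeuron_pairUp {r : ℕ} {b : ℕ → X → ℝ} {F : Fin r × Fin 6 → X → ℝ}
    (hF : ∀ i : Fin r, F (i, 0) = b i) (hb : ∀ i x, 0 ≤ b i x) (hbr : ∀ i x, r ≤ i → b i x = 1)
    (q : Fin r × Fin 6) : IsNeuron 6 F (pairUp r b q) := by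
  have key (i : ℕ) : IsNeuron 6 F (b i) := by
    rcases lt_or_ge i r with hi | hi
    · refine ⟨Pi.single (⟨i, hi⟩, 0) 1, 0, fun k => ?_, by simp, ?_, fun x => ?_⟩
      · rcases eq_or_ne k (⟨i, hi⟩, 0) with rfl | hk
        · simp
        · simp [hk]
      · refine (Set.ncard_le_ncard (t := {(⟨i, hi⟩, 0)}) fun k hk => ?_).trans (by simp)
        by_contra hk'
        exact hk (Pi.single_eq_of_ne hk' _)
      · simp [Pi.single_apply, hF, relu_of_nonneg (hb i x)]
    · exact ⟨0, -1, by simp, by simp, by simp, fun x => by simp [hbr i x hi, relu]⟩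
  obtain ⟨i, j⟩ := q
  fin_cases j
  · exact key _
  · exact key _
  all_goals exact isNeuron_zero _

lemma exists_layerChain_mulTree {r : ℕ} (n : ℕ) {a : ℕ → X → ℝ}
    (ha : ∀ i x, a i x ∈ Set.Icc (0 : ℝ) 1) (har : ∀ i x, r ≤ i → a i x = 1)
    {F : Fin r × Fin 6 → X → ℝ} (hF : ∀ i : Fin r, F (i, 0) = a i) (t : ℕ) :
    ∃ G, LayerChain 6 F ((n + 3) * t) G ∧
      ∀ i : Fin r, G (i, 0) = fun x => mulTree r n (fun j => a j x) t i := by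
  induction t with
  | zero => exact ⟨F, .refl, hF⟩
  | succ t ih =>
    obtain ⟨G, hG, hGi⟩ := ih
    let b : ℕ → X → ℝ := fun i x => mulTree r n (fun j => a j x) t i
    have hb i x : b i x ∈ Set.Icc (0 : ℝ) 1 := mulTree_mem n (fun j => ha j x) t i
    have h1 := LayerChain.single (isNeuron_pairUp hGi (fun i x => (hb i x).1)
      fun i x hi => mulTree_of_le n (fun j => har j x) t hi)
    have h2 := LayerChain.prod (c := 6) (F := fun (i : Fin r) j => pairUp r b (i, j))
      (G := fun i => mulState n (b (2 * i)) (b (2 * i + 1)))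
      fun i => layerChain_mulState n (hb _) (hb _)
    have h3 := (hG.trans h1).trans h2
    rw [show (n + 3) * t + 1 + (n + 2) = (n + 3) * (t + 1) by ring] at h3
    refine ⟨_, h3, fun i => ?_⟩
    funext x
    simp [mulTree, mulState, b]

end Product

/-! ## Realization as sparse networks -/

lemma matSupp_le {a b c : ℕ} (W : Matrix (Fin a) (Fin b) ℝ)
    (h : ∀ i, {j | W i j ≠ 0}.ncard ≤ c) : matSupp W ≤ a * c := by
  classical
  have h' : matSupp W = ∑ i, {j | W i j ≠ 0}.ncard := by
    simp only [matSupp, Set.ncard_eq_toFinset_card', Set.toFinset_ofPred, Finset.card_filter,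
      Fintype.sum_prod_type]
  rw [h']
  exact (Finset.sum_le_sum fun i _ => h i).trans (by simp)

lemma vecSupp_le {a : ℕ} (v : Fin a → ℝ) : vecSupp v ≤ a :=
  (Set.ncard_le_card _).trans (by simp)

lemma exists_network {X : Type*} (L : ℕ) (p : ℕ → ℕ) (c : ℕ → ℕ) (S : ∀ i, Fin (p i) → X → ℝ)
    (hS : ∀ i < L, ∀ k, IsNeuron (c i) (S i) (S (i + 1) k))
    (hout : ∀ k, ∃ j, S (L + 1) k = S L j) :
    ∃ g ∈ SparseNetClass L p (∑ i ∈ Finset.range L, p (i + 1) * (c i + 1) + p (L + 1)),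
      ∀ x k, g (fun j => S 0 j x) k = S (L + 1) k x := by
  have key : ∀ i, ∃ (W : Matrix (Fin (p (i + 1))) (Fin (p i)) ℝ) (b : Fin (p (i + 1)) → ℝ),
      (∀ j k, |W j k| ≤ 1) ∧ (∀ j, |b j| ≤ 1) ∧
      (i < L → (∀ j, {k | W j k ≠ 0}.ncard ≤ c i) ∧
        ∀ x j, S (i + 1) j x = relu (W.mulVec (fun k => S i k x) j - b j)) ∧
      (i = L → (∀ j, {k | W j k ≠ 0}.ncard ≤ 1) ∧
        ∀ x j, W.mulVec (fun k => S i k x) j = S (i + 1) j x) := by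
    intro i
    rcases lt_trichotomy i L with h | rfl | h
    · choose W b hW hb hc hf using hS i h
      exact ⟨W, b, hW, hb, fun _ => ⟨hc, fun x j => hf j x⟩, fun h' => absurd h' h.ne⟩
    · choose e he using hout
      refine ⟨fun j => Pi.single (e j) 1, 0, fun j k => ?_, by simp,
        fun h' => absurd h' (lt_irrefl _), fun _ => ⟨fun j => ?_, fun x j => ?_⟩⟩
      · rcases eq_or_ne k (e j) with rfl | hk
        · simp
        · simp [hk]
      · refine (Set.ncard_le_ncard (t := {e j}) fun k hk => ?_).trans (by simp)
        by_contra hk'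
        exact hk (Pi.single_eq_of_ne hk' _)
      · rw [he]
        exact single_one_dotProduct _ _
    · exact ⟨0, 0, by simp, by simp, fun h' => absurd h' h.not_gt, fun h' => absurd h' h.ne'⟩
  choose W b hW hb hlt heq using key
  let v : ∀ i, Fin (p i) → ℝ := fun i => match i with
    | 0 => 0
    | i + 1 => b i
  refine ⟨networkFun L p W v, ⟨W, v, hW, fun i => ?_, ?_, rfl⟩, fun x k => ?_⟩
  · cases i with
    | zero => simp [v]
    | succ i => exact hb i
  · have h1 : ∑ i ∈ Finset.Icc 1 L, vecSupp (v i) = ∑ i ∈ Finset.range L, vecSupp (v (i + 1)) := by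
      rw [Finset.range_eq_Ico, Finset.sum_Ico_add' (fun i => vecSupp (v i)) 0 L 1]
      rfl
    have h2 : ∑ i ∈ Finset.range L, (matSupp (W i) + vecSupp (v (i + 1))) ≤
        ∑ i ∈ Finset.range L, p (i + 1) * (c i + 1) := Finset.sum_le_sum fun i hi => by
      have h3 := matSupp_le _ (hlt i (Finset.mem_range.1 hi)).1
      have h4 := vecSupp_le (v (i + 1))
      linarith
    have h5 := matSupp_le _ (heq L rfl).1
    rw [Finset.sum_add_distrib] at h2
    rw [totalSparsity, Finset.sum_range_succ, h1]
    linarith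
  · have h : ∀ i ≤ L, netLayers p W v (fun j => S 0 j x) i = (W i).mulVec fun k => S i k x := by
      intro i
      induction i with
      | zero => exact fun _ => rfl
      | succ i ih =>
        intro hi
        simp only [netLayers, ih (by omega)]
        congr 1
        funext j
        exact ((hlt i (by omega)).2 x j).symm
    rw [networkFun, h L le_rfl, (heq L rfl).2]

lemma exists_network_of_hidden {X ι : Type*} [Fintype ι] {L : ℕ} (hL : 1 ≤ L) {p : ℕ → ℕ}
    (hp : ∀ i, 1 ≤ i → i ≤ L → p i = Fintype.card ι) (c : ℕ → ℕ) (inp : X → Fin (p 0) → ℝ)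
    (T : ℕ → ι → X → ℝ) (h0 : ∀ k, IsNeuron (c 0) (fun j x => inp x j) (T 1 k))
    (hT : ∀ i, 1 ≤ i → i < L → ∀ k, IsNeuron (c i) (T i) (T (i + 1) k))
    (out : Fin (p (L + 1)) → ι) :
    ∃ g ∈ SparseNetClass L p
      (∑ i ∈ Finset.range L, Fintype.card ι * (c i + 1) + p (L + 1)),
      ∀ x k, g (inp x) k = T L (out k) x := by
  let E (i : ℕ) (h : 1 ≤ i ∧ i ≤ L) : Fin (p i) ≃ ι :=
    (Fintype.equivFinOfCardEq (hp i h.1 h.2).symm).symm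
  let S : ∀ i, Fin (p i) → X → ℝ := fun i k x =>
    if h : 1 ≤ i ∧ i ≤ L then T i (E i h k) x
    else if h : i = 0 then inp x (Fin.cast (by rw [h]) k)
    else if h : i = L + 1 then T L (out (Fin.cast (by rw [h]) k)) x else 0
  have hS0 : S 0 = fun j x => inp x j := by simp [S]
  have hSi i (h : 1 ≤ i ∧ i ≤ L) : S i = fun k => T i (E i h k) := by
    funext k x
    simp only [S, h, and_self, dite_true]
  have hSL : S (L + 1) = fun k => T L (out k) := by
    funext k x
    simp [S]
  have hS : ∀ i < L, ∀ k, IsNeuron (c i) (S i) (S (i + 1) k) := by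
    intro i hi k
    rw [hSi (i + 1) ⟨by omega, hi⟩]
    rcases Nat.eq_zero_or_pos i with rfl | hi0
    · rw [hS0]
      exact h0 _
    · refine IsNeuron.of_embedding (E i ⟨hi0, hi.le⟩).symm.toEmbedding ?_
      rw [hSi i ⟨hi0, hi.le⟩]
      simpa using hT i hi0 hi _
  have hout : ∀ k, ∃ j, S (L + 1) k = S L j := by
    intro k
    refine ⟨(E L ⟨hL, le_rfl⟩).symm (out k), ?_⟩
    rw [hSL, hSi L ⟨hL, le_rfl⟩]
    simp
  obtain ⟨g, hg, hgS⟩ := exists_network L p c S hS hout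
  refine ⟨g, ?_, fun x k => ?_⟩
  · have hsum : ∑ i ∈ Finset.range L, Fintype.card ι * (c i + 1) =
        ∑ i ∈ Finset.range L, p (i + 1) * (c i + 1) := Finset.sum_congr rfl fun i hi => by
      rw [hp (i + 1) (by omega) (Finset.mem_range.1 hi)]
    rwa [hsum]
  · rw [hS0, hSL] at hgS
    exact hgS x k

/-! ## Products of hat functions -/

/-- Extension of a finite family of reals by `1`. -/
def extendOne {r : ℕ} (h : Fin r → ℝ) (j : ℕ) : ℝ := if hj : j < r then h ⟨j, hj⟩ else 1

lemma extendOne_of_le {r : ℕ} (h : Fin r → ℝ) {j : ℕ} (hj : r ≤ j) : extendOne h j = 1 := by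
  simp [extendOne, hj.not_gt]

lemma extendOne_mem {r : ℕ} {h : Fin r → ℝ} (hh : ∀ j, h j ∈ Set.Icc (0 : ℝ) 1) (j : ℕ) :
    extendOne h j ∈ Set.Icc (0 : ℝ) 1 := by
  unfold extendOne
  split_ifs
  · exact hh _
  · simp

lemma prod_block_extendOne {r : ℕ} (h : Fin r → ℝ) :
    ∏ j ∈ Finset.range (2 ^ Nat.clog 2 r), extendOne h (0 * 2 ^ Nat.clog 2 r + j) =
      ∏ j, h j := by
  have h1 : ∏ j, h j = ∏ j ∈ Finset.range r, extendOne h j := by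
    rw [Finset.prod_range]
    exact Finset.prod_congr rfl fun j _ => by simp [extendOne]
  rw [h1]
  simp only [zero_mul, zero_add]
  refine (Finset.prod_subset (Finset.range_subset_range.2 (Nat.le_pow_clog one_lt_two r))
    fun j _ hj => extendOne_of_le h (by simpa using hj)).symm

lemma two_pow_clog_le {r : ℕ} (hr : 1 ≤ r) : 2 ^ Nat.clog 2 r ≤ 2 * r := by
  rcases hr.eq_or_lt with rfl | h
  · simp
  · have h1 := Nat.pow_pred_clog_lt_self one_lt_two h
    have h2 : Nat.clog 2 r = (Nat.clog 2 r).pred + 1 :=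
      (Nat.succ_pred_eq_of_pos (Nat.clog_pos one_lt_two h)).symm
    rw [h2, pow_succ]
    omega

lemma abs_mulTree_clog_sub_prod_le {r : ℕ} (hr : 1 ≤ r) (m : ℕ) {h : Fin r → ℝ}
    (hh : ∀ j, h j ∈ Set.Icc (0 : ℝ) 1) :
    |mulTree r (m + 2) (extendOne h) (Nat.clog 2 r) 0 - ∏ j, h j| ≤
      (r : ℝ) ^ 2 * ((2 : ℝ) ^ m)⁻¹ := by
  have h1 := abs_mulTree_sub_le (m + 2) (extendOne_mem hh) (fun _ => extendOne_of_le h)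
    (Nat.clog 2 r) 0
  rw [prod_block_extendOne] at h1
  refine h1.trans ?_
  have h2 : (2 : ℝ) ^ Nat.clog 2 r ≤ 2 * r := by exact_mod_cast two_pow_clog_le hr
  have h3 : (1 / 4 : ℝ) ^ (m + 2) ≤ (2 ^ m)⁻¹ := by
    rw [← inv_pow]
    calc (1 / 4 : ℝ) ^ (m + 2) ≤ (1 / 4) ^ m :=
          pow_le_pow_of_le_one (by norm_num) (by norm_num) (by omega)
      _ ≤ 2⁻¹ ^ m := pow_le_pow_left₀ (by norm_num) (by norm_num) m
  gcongr
  nlinarith [sq_nonneg ((r : ℝ) - 1)]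

lemma mulTree_clog_eq_zero {r : ℕ} (n : ℕ) {h : Fin r → ℝ} (hh : ∀ j, h j ∈ Set.Icc (0 : ℝ) 1)
    (h0 : ∏ j, h j = 0) : mulTree r n (extendOne h) (Nat.clog 2 r) 0 = 0 :=
  mulTree_eq_zero n (extendOne_mem hh) (fun _ => extendOne_of_le h) _ _
    ((prod_block_extendOne h).trans h0)

/-- The hat function of height and half-width `1 / M` centered at `a / M`. -/
def hat (M a : ℕ) (x : ℝ) : ℝ := max ((M : ℝ)⁻¹ - |x - (a : ℝ) / (M : ℝ)|) 0

lemma hat_mem {M : ℕ} (hM : 1 ≤ M) (a : ℕ) (x : ℝ) : hat M a x ∈ Set.Icc (0 : ℝ) 1 := by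
  have h : (M : ℝ)⁻¹ ≤ 1 := inv_le_one_of_one_le₀ (by exact_mod_cast hM)
  exact ⟨le_max_right _ _, max_le (by linarith [abs_nonneg (x - a / M)]) zero_le_one⟩

section HatLayers

variable {X K : Type*} {r : ℕ} (M : ℕ) (inp : X → Fin r → ℝ) (ℓ : K → Fin r → ℕ)

/-- First layer of the network computing the hat functions. -/
def hatFirst (q : K × Fin r × Fin 6) : X → ℝ :=
  ![fun x => relu (inp x q.2.1 - ℓ q.1 q.2.1 / M), fun x => relu (-inp x q.2.1 + ℓ q.1 q.2.1 / M),
    0, 0, 0, 0] q.2.2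

/-- Second layer of the network computing the hat functions. -/
def hatSecond (q : K × Fin r × Fin 6) : X → ℝ :=
  ![fun x => hat M (ℓ q.1 q.2.1) (inp x q.2.1), 0, 0, 0, 0, 0] q.2.2

variable {M ℓ}

lemma isNeuron_hatFirst (hℓ : ∀ k j, ℓ k j ≤ M) (q : K × Fin r × Fin 6) :
    IsNeuron 1 (fun j x => inp x j) (hatFirst M inp ℓ q) := by
  obtain ⟨k, j, i⟩ := q
  have hb : |(ℓ k j / M : ℝ)| ≤ 1 := by
    rw [abs_of_nonneg (by positivity)]
    exact div_le_one_of_le₀ (by exact_mod_cast hℓ k j) (by positivity)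
  let e : Unit ↪ Fin r := ⟨fun _ => j, fun _ _ _ => rfl⟩
  fin_cases i
  · exact .of_embedding e (isNeuron_card _ (fun _ => 1) _ (by simp) hb
      fun x => by
        simp only [Finset.univ_unique, Finset.sum_singleton]
        refine congrArg relu ?_
        change _ = _ * inp x j - _
        ring)
  · exact .of_embedding e (isNeuron_card _ (fun _ => -1) (-(ℓ k j / M)) (by simp)
      (by rwa [abs_neg]) fun x => by
        simp only [Finset.univ_unique, Finset.sum_singleton]
        refine congrArg relu ?_
        change _ = _ * inp x j - _
        ring)
  all_goals exact isNeuron_zero _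

lemma isNeuron_hatSecond [Fintype K] (hM : 1 ≤ M) (q : K × Fin r × Fin 6) :
    IsNeuron 2 (hatFirst M inp ℓ) (hatSecond M inp ℓ q) := by
  obtain ⟨k, j, i⟩ := q
  have hb : |-(M : ℝ)⁻¹| ≤ 1 := by
    rw [abs_neg, abs_of_nonneg (by positivity)]
    exact inv_le_one_of_one_le₀ (by exact_mod_cast hM)
  let e : Fin 2 ↪ K × Fin r × Fin 6 :=
    ⟨fun i => (k, j, Fin.castLE (by norm_num) i), fun a b h => by simpa using h⟩
  fin_cases i
  · refine .of_embedding e (isNeuron_card _ (fun _ => -1) _ (by simp) hb fun x => ?_)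
    have h := abs_div_two_eq_relu_add_relu (2 * (inp x j - ℓ k j / M))
    rw [abs_mul, abs_two, neg_mul_eq_mul_neg, mul_div_cancel_left₀ _ two_ne_zero,
      mul_div_cancel_left₀ _ two_ne_zero, mul_div_cancel_left₀ _ two_ne_zero] at h
    simp only [Fin.sum_univ_two]
    change relu _ = relu (-1 * relu (inp x j - ℓ k j / M) + -1 * relu (-inp x j + ℓ k j / M) - _)
    congr 1
    change (M : ℝ)⁻¹ - |inp x j - ℓ k j / M| = _
    rw [h, neg_sub, neg_add_eq_sub]
    ring
  all_goals exact isNeuron_zero _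

end HatLayers

lemma sparsity_le {r N n : ℕ} (hr : 1 ≤ r) :
    6 * r * N * 2 + 6 * r * N * 3 + n * (6 * r * N * 7) + N ≤ 49 * r ^ 2 * N * (1 + n) := by
  obtain ⟨k, rfl⟩ := Nat.exists_eq_add_of_le hr
  nlinarith [Nat.zero_le (k * N), Nat.zero_le (k * k * N), Nat.zero_le (n * N),
    Nat.zero_le (k * N * n), Nat.zero_le (k * k * N * n)]

/-- (Lemma B.2: ReLU network computing, up to error `r² 2^{-m}`,
all products of hat functions centered at the grid `D(M)`; the output
coordinates are indexed through the injection `ind` of the grid points). -/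
theorem statement18 (r M m : ℕ) (hr : 1 ≤ r) (hM : 1 ≤ M) (hm : 1 ≤ m)
    (L : ℕ) (hL : L = 2 + (m + 5) * Nat.clog 2 r)
    (p : ℕ → ℕ) (hp0 : p 0 = r) (hpL : p (L + 1) = (M + 1) ^ r)
    (hpmid : ∀ i, 1 ≤ i → i ≤ L → p i = 6 * r * (M + 1) ^ r) :
    ∃ s ≤ 49 * r ^ 2 * (M + 1) ^ r * (1 + (m + 5) * Nat.clog 2 r),
    ∃ g ∈ SparseNetClassB L p s 1, ∃ h0 : p 0 = r,
    ∃ ind : (Fin r → ℕ) → Fin (p (L + 1)),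
      Set.InjOn ind ↑(Fintype.piFinset fun _ : Fin r => Finset.range (M + 1)) ∧
      ∀ x ∈ unitCube r,
        (∀ j, g (fun k => x (Fin.cast h0 k)) j ∈ Set.Icc (0 : ℝ) 1) ∧
        ∀ ℓ ∈ Fintype.piFinset (fun _ : Fin r => Finset.range (M + 1)),
          |g (fun k => x (Fin.cast h0 k)) (ind ℓ) -
              ∏ j, max ((M : ℝ)⁻¹ - |x j - (ℓ j : ℝ) / (M : ℝ)|) 0| ≤
            (r : ℝ) ^ 2 * ((2 : ℝ) ^ m)⁻¹ ∧
          (g (fun k => x (Fin.cast h0 k)) (ind ℓ) ≠ 0 →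
            (∏ j, max ((M : ℝ)⁻¹ - |x j - (ℓ j : ℝ) / (M : ℝ)|) 0) ≠ 0) := by
  subst hp0
  set r := p 0 with hr0
  let X := unitCube r
  let K := Fin r → Fin (M + 1)
  let ℓK : K → Fin r → ℕ := fun k j => k j
  let inp : X → Fin r → ℝ := fun x => x
  let f (k : K) (x : X) (j : Fin r) : ℝ := hat M (ℓK k j) (inp x j)
  have hf k x j : f k x j ∈ Set.Icc (0 : ℝ) 1 := hat_mem hM _ _
  have hex (k : K) := exists_layerChain_mulTree (m + 2)
    (a := fun j x => extendOne (f k x) j) (F := fun q => hatSecond M inp ℓK (k, q))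
    (fun i x => extendOne_mem (hf k x) i) (fun i x hi => extendOne_of_le _ hi)
    (fun i => by funext x; simp [extendOne, f, hatSecond]) (Nat.clog 2 r)
  choose G hG hGi using hex
  obtain ⟨T, hT0, hTn, hT⟩ := (LayerChain.prod hG).exists_seq
  set n := (m + 5) * Nat.clog 2 r with hn
  let H : ℕ → K × Fin r × Fin 6 → X → ℝ := fun i => match i with
    | 0 => 0
    | 1 => hatFirst M inp ℓK
    | i + 2 => T i
  let c : ℕ → ℕ := fun i => match i with
    | 0 => 1
    | 1 => 2
    | _ + 2 => 6
  have hcard : Fintype.card (K × Fin r × Fin 6) = 6 * r * (M + 1) ^ r := by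
    simp [K]
    ring
  let out : Fin (p (L + 1)) ≃ K := (finCongr hpL).trans finFunctionFinEquiv.symm
  obtain ⟨g, hg, hgT⟩ := exists_network_of_hidden (L := L) (by omega)
    (fun i h1 h2 => (hpmid i h1 h2).trans hcard.symm) c inp H
    (isNeuron_hatFirst inp fun k j => Nat.lt_succ_iff.1 (k j).2)
    (fun i h1 h2 => by
      rcases i with _ | _ | i
      · omega
      · intro q
        simp only [H, hT0]
        exact isNeuron_hatSecond inp hM q
      · exact hT i (by omega))
    fun k => (out k, ⟨0, hr⟩, 0)
  have hval (x : X) (k) :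
      g x k = mulTree r (m + 2) (extendOne (f (out k) x)) (Nat.clog 2 r) 0 := by
    have h1 := hgT x k
    have h2 : H L = T n := by rw [hL, add_comm]
    rw [h2, hTn] at h1
    exact h1.trans (congrFun (hGi (out k) ⟨0, hr⟩) x)
  have hmem (x : X) (k) : g x k ∈ Set.Icc (0 : ℝ) 1 := by
    rw [hval]
    exact mulTree_mem _ (extendOne_mem (hf _ x)) _ _
  refine ⟨_, ?_, g, ⟨hg, fun x hx j => ?_⟩, rfl,
    fun ℓ => out.symm fun j => Fin.ofNat (M + 1) (ℓ j), ?_, fun x hx => ⟨fun j => ?_, ?_⟩⟩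
  · rw [hcard, hpL, hL, add_comm 2 n, Finset.sum_range_succ', Finset.sum_range_succ']
    simp only [c, Finset.sum_const, Finset.card_range, smul_eq_mul]
    have := sparsity_le (N := (M + 1) ^ r) (n := n) hr
    linarith
  · have h := hmem ⟨x, hx⟩ j
    rw [abs_of_nonneg h.1]
    exact h.2
  · intro ℓ hℓ ℓ' hℓ' h
    have h' := out.symm.injective h
    funext j
    simp only [Finset.mem_coe, Fintype.mem_piFinset, Finset.mem_range] at hℓ hℓ'
    have := congrArg Fin.val (congrFun h' j)
    simpa [Fin.ofNat, Nat.mod_eq_of_lt (hℓ j), Nat.mod_eq_of_lt (hℓ' j)] using this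
  · exact hmem ⟨x, hx⟩ j
  · intro ℓ hℓ
    simp only [Fintype.mem_piFinset, Finset.mem_range] at hℓ
    have hfx : f (fun j => Fin.ofNat (M + 1) (ℓ j)) ⟨x, hx⟩ =
        fun j => max ((M : ℝ)⁻¹ - |x j - (ℓ j : ℝ) / (M : ℝ)|) 0 := by
      funext j
      simp [f, ℓK, inp, hat, Nat.mod_eq_of_lt (hℓ j)]
    have h1 := hval ⟨x, hx⟩ (out.symm fun j => Fin.ofNat (M + 1) (ℓ j))
    have hh := hf (fun j => Fin.ofNat (M + 1) (ℓ j)) ⟨x, hx⟩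
    rw [Equiv.apply_symm_apply, hfx] at h1
    rw [hfx] at hh
    change g x _ = _ at h1
    simp only [Fin.cast_refl, id_eq]
    rw [h1]
    exact ⟨abs_mulTree_clog_sub_prod_le hr m hh, mt (mulTree_clog_eq_zero _ hh)⟩

end
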